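/- Define inductively the symbols a₀ = a and a_{n+1}(ξ₀,…,ξ_{n+1}) = 2iπ ∑_{k=0}^{n} [a_n(ξ₀,…,ξ_k+ξ_{n+1},…,ξ_n) − a_n(ξ₀,…,ξ_n)] ⊗ ξ_k^♯, where a is a smooth S^r symbol. Then for each n there is C_n > 0 such that ‖a_n(ξ₀,…,ξ_n)‖ ≤ C_n (∏_{k=0}^{n} (1+|ξ_k|²)^{1/2}) (∑_{J ⊆ {1,…,n}} (1+|ξ₀ + ∑_{j∈J} ξ_j|²)^{(r−1)/2}) for all ξ₀,…,ξ_n ∈ ℝ^d. -/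

import Mathlib

noncomputable section

variable (d : ℕ)

/-- `λ_s(ξ) = (1+|ξ|²)^{s/2}`. -/
def lamW (s : ℝ) (ξ : EuclideanSpace ℝ (Fin d)) : ℝ := (1 + ‖ξ‖ ^ 2) ^ (s / 2)

/-- `ξ^♯(X) = ξ·X` for `ξ ∈ ℝ^d`, `X ∈ ℂ^d`. -/
def dotC (ξ : EuclideanSpace ℝ (Fin d)) (X : EuclideanSpace ℂ (Fin d)) : ℂ :=
  ∑ i, (ξ i : ℂ) * X i

/-- The inductively defined multilinear symbols: `a₀ = a` and
`a_{n+1}(ξ₀,…,ξ_{n+1}) = 2iπ ∑_{k=0}^n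
  [a_n(ξ₀,…,ξ_k+ξ_{n+1},…,ξ_n) − a_n(ξ₀,…,ξ_n)] ⊗ ξ_k^♯`,
written here in uncurried form: `aN a n ξ X = a_n(ξ₀,…,ξ_n)[X₀,…,X_n]`. -/
def aN (a : EuclideanSpace ℝ (Fin d) →
      (EuclideanSpace ℂ (Fin d) →L[ℂ] EuclideanSpace ℂ (Fin d))) :
    (n : ℕ) → (Fin (n + 1) → EuclideanSpace ℝ (Fin d)) →
      (Fin (n + 1) → EuclideanSpace ℂ (Fin d)) → EuclideanSpace ℂ (Fin d)
  | 0, ξ, X => a (ξ 0) (X 0)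
  | n + 1, ξ, X =>
      (((2 * Real.pi : ℝ) : ℂ) * Complex.I) •
        ∑ k : Fin (n + 1),
          dotC d (ξ k.castSucc) (X (Fin.last (n + 1))) •
            (aN a n
                (Function.update (fun j : Fin (n + 1) => ξ j.castSucc) k
                  (ξ k.castSucc + ξ (Fin.last (n + 1))))
                (fun j => X j.castSucc)
              - aN a n (fun j => ξ j.castSucc) (fun j => X j.castSucc))

section IteratedCommutator

variable {ι E F : Type*} [DecidableEq ι] [NormedAddCommGroup E] [NormedSpace ℝ E]
  [NormedAddCommGroup F] [NormedSpace ℂ F]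

/-- The operator `f ↦ ∑_{k ∈ s} φ_j(v_k) (f(…, v_k + v_j, …) - f(v))`. -/
def shiftDeriv (φ : ι → E →L[ℝ] ℂ) (s : Finset ι) (j : ι) (f : (ι → E) → F) (v : ι → E) : F :=
  ∑ k ∈ s, φ j (v k) • (f (v + Pi.single k (v j)) - f v)

/-- The iterated symbol with base index `o`; the variables in the list are adjoined from the
last one to the first one. -/
def iterSymbol (φ : ι → E →L[ℝ] ℂ) (o : ι) (a : E → F) : List ι → (ι → E) → F
  | [], v => a (v o)
  | j :: l, v => shiftDeriv φ (insert o l.toFinset) j (iterSymbol φ o a l) v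

theorem iterSymbol_congr (φ : ι → E →L[ℝ] ℂ) (o : ι) (a : E → F) (l : List ι) {v w : ι → E}
    (ho : v o = w o) (hl : ∀ j ∈ l, v j = w j) :
    iterSymbol φ o a l v = iterSymbol φ o a l w := by
  induction l generalizing v w with
  | nil => simp [iterSymbol, ho]
  | cons j l ih =>
    simp only [iterSymbol, shiftDeriv]
    have hj : v j = w j := hl j (by simp)
    have hl' : ∀ i ∈ l, v i = w i := fun i hi => hl i (by simp [hi])
    refine Finset.sum_congr rfl fun k hk => ?_
    have hk' : v k = w k := by
      rcases Finset.mem_insert.1 hk with rfl | hk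
      · exact ho
      · exact hl' k (by simpa using hk)
    have h : iterSymbol φ o a l (v + Pi.single k (v j)) =
        iterSymbol φ o a l (w + Pi.single k (w j)) :=
      ih (by simp [ho, hj]) fun i hi => by simp [hl' i hi, hj]
    rw [hk', ih ho hl', h]

theorem iterSymbol_add_single (φ : ι → E →L[ℝ] ℂ) {o : ι} (a : E → F) {l : List ι} {i : ι}
    (hio : i ≠ o) (hi : i ∉ l) (v : ι → E) (x : E) :
    iterSymbol φ o a l (v + Pi.single i x) = iterSymbol φ o a l v :=
  iterSymbol_congr φ o a l (by simp [hio.symm]) fun j hj => by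
    have : j ≠ i := fun h => hi (h ▸ hj)
    simp [this]

theorem shiftDeriv_shiftDeriv (φ : ι → E →L[ℝ] ℂ) {s : Finset ι} {i j : ι}
    (hi : i ∉ s) (f : (ι → E) → F) (hfi : ∀ v x, f (v + Pi.single i x) = f v) (v : ι → E) :
    shiftDeriv φ (insert i s) j (shiftDeriv φ s i f) v =
      (∑ k ∈ s, φ j (v k) • ∑ m ∈ s, φ i (v m) •
        (f (v + Pi.single k (v j) + Pi.single m (v i)) - f (v + Pi.single k (v j))
          - f (v + Pi.single m (v i)) + f v)) +
      ((∑ k ∈ s, (φ j (v k) * φ i (v j)) •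
        (f (v + Pi.single k (v i + v j)) - f (v + Pi.single k (v j)))) +
      ∑ k ∈ s, (φ i (v k) * φ j (v i)) •
        (f (v + Pi.single k (v i + v j)) - f (v + Pi.single k (v i)))) := by
  rw [shiftDeriv, Finset.sum_insert hi, add_comm, ← add_assoc]
  congr 1
  · rw [← Finset.sum_add_distrib]
    refine Finset.sum_congr rfl fun k hk => ?_
    have hki : i ≠ k := fun h => hi (h ▸ hk)
    simp only [shiftDeriv]
    rw [mul_smul, ← smul_add, ← Finset.sum_sub_distrib]
    congr 1
    have : φ i (v j) • (f (v + Pi.single k (v i + v j)) - f (v + Pi.single k (v j))) =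
        ∑ m ∈ s, φ i ((Pi.single k (v j) : ι → E) m) •
          (f (v + Pi.single k (v j) + Pi.single m (v i)) - f (v + Pi.single k (v j))) := by
      rw [Finset.sum_eq_single_of_mem k hk]
      · rw [Pi.single_eq_same, add_assoc, ← Pi.single_add, add_comm (v j)]
      · intro m _ hm
        simp [hm]
    rw [this, ← Finset.sum_add_distrib]
    refine Finset.sum_congr rfl fun m _ => ?_
    simp only [Pi.add_apply, Pi.single_eq_of_ne hki, add_zero, map_add, add_smul, smul_sub,
      smul_add]
    abel
  · simp only [shiftDeriv]
    rw [← Finset.sum_sub_distrib, Finset.smul_sum]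
    refine Finset.sum_congr rfl fun k hk => ?_
    have hki : k ≠ i := fun h => hi (h ▸ hk)
    rw [hfi, add_right_comm, hfi]
    simp only [Pi.add_apply, Pi.single_eq_same, Pi.single_eq_of_ne hki, add_zero]
    rw [← smul_sub, smul_smul, mul_comm]
    congr 1
    abel

theorem shiftDeriv_comm (φ : ι → E →L[ℝ] ℂ) {s : Finset ι} {i j : ι}
    (hi : i ∉ s) (hj : j ∉ s) (f : (ι → E) → F)
    (hfi : ∀ v x, f (v + Pi.single i x) = f v) (hfj : ∀ v x, f (v + Pi.single j x) = f v)
    (v : ι → E) :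
    shiftDeriv φ (insert i s) j (shiftDeriv φ s i f) v =
      shiftDeriv φ (insert j s) i (shiftDeriv φ s j f) v := by
  rw [shiftDeriv_shiftDeriv φ hi f hfi, shiftDeriv_shiftDeriv φ hj f hfj]
  congr 1
  · simp only [Finset.smul_sum, smul_smul]
    rw [Finset.sum_comm]
    refine Finset.sum_congr rfl fun k _ => Finset.sum_congr rfl fun m _ => ?_
    rw [mul_comm, add_right_comm v]
    congr 1
    abel
  · rw [add_comm, add_comm (v j)]

theorem iterSymbol_perm (φ : ι → E →L[ℝ] ℂ) (o : ι) (a : E → F) {l l' : List ι} (h : l.Perm l')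
    (hl : (o :: l).Nodup) : iterSymbol φ o a l = iterSymbol φ o a l' := by
  induction h with
  | nil => rfl
  | cons j h ih =>
    funext v
    simp only [List.nodup_cons, List.mem_cons] at hl ih
    simp only [iterSymbol]
    rw [ih (by tauto), List.toFinset_eq_of_perm _ _ h]
  | swap i j l =>
    funext v
    simp only [List.nodup_cons, List.mem_cons, not_or] at hl
    simp only [iterSymbol, List.toFinset_cons]
    rw [Finset.insert_comm, Finset.insert_comm o j]
    have h1 : ∀ v x, iterSymbol φ o a l (v + Pi.single i x) = iterSymbol φ o a l v :=
      iterSymbol_add_single φ a (by tauto) (by tauto)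
    have h2 : ∀ v x, iterSymbol φ o a l (v + Pi.single j x) = iterSymbol φ o a l v :=
      iterSymbol_add_single φ a (by tauto) (by tauto)
    apply shiftDeriv_comm φ _ _ _ h1 h2
    · simp only [Finset.mem_insert, List.mem_toFinset]; tauto
    · simp only [Finset.mem_insert, List.mem_toFinset]; tauto
  | trans h₁ h₂ ih₁ ih₂ =>
    rw [ih₁ hl, ih₂ ((h₁.cons o).nodup_iff.1 hl)]

theorem iterSymbol_eq_zero (φ : ι → E →L[ℝ] ℂ) {o : ι} (a : E → F) {l : List ι}
    (hl : (o :: l).Nodup) {j : ι} (hj : j ∈ l) {v : ι → E} (hv : v j = 0) :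
    iterSymbol φ o a l v = 0 := by
  induction l generalizing v with
  | nil => simp at hj
  | cons i l ih =>
    simp only [iterSymbol, shiftDeriv]
    simp only [List.nodup_cons, List.mem_cons, not_or] at hl ih hj
    refine Finset.sum_eq_zero fun k _ => ?_
    rcases hj with rfl | hj
    · simp [hv]
    · by_cases hkj : k = j
      · simp [hkj, hv]
      · rw [ih (by tauto) hj hv, ih (by tauto) hj]
        · simp
        · simp [hv, Ne.symm hkj]

/-- The multilinear factor attached to a set `P` of variables attached between the base
index `o` and the index `i`. -/
def pathFactor (φ : ι → E →L[ℝ] ℂ) (o i : ι) : List ι → (ι → E) → ℂ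
  | [], v => φ i (v o)
  | j :: P, v => ∑ k ∈ insert o P.toFinset,
      φ j (v k) * pathFactor φ o i P (Function.update v k (v j))

theorem pathFactor_congr (φ : ι → E →L[ℝ] ℂ) (o i : ι) (P : List ι) {v w : ι → E}
    (ho : v o = w o) (hP : ∀ j ∈ P, v j = w j) :
    pathFactor φ o i P v = pathFactor φ o i P w := by
  induction P generalizing v w with
  | nil => simp [pathFactor, ho]
  | cons j P ih =>
    simp only [pathFactor]
    have hj : v j = w j := hP j (by simp)
    have hP' : ∀ i ∈ P, v i = w i := fun i hi => hP i (by simp [hi])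
    refine Finset.sum_congr rfl fun k hk => ?_
    have hk' : v k = w k := by
      rcases Finset.mem_insert.1 hk with rfl | hk
      · exact ho
      · exact hP' k (by simpa using hk)
    rw [hk', hj, ih]
    · simp only [Function.update_apply, ho]
    · intro m hm
      simp only [Function.update_apply, hP' m hm]

theorem pathFactor_update (φ : ι → E →L[ℝ] ℂ) {o i : ι} {P : List ι} {k : ι}
    (hk : k ≠ o) (hkP : k ∉ P) (v : ι → E) (x : E) :
    pathFactor φ o i P (Function.update v k x) = pathFactor φ o i P v :=
  pathFactor_congr φ o i P (by simp [hk.symm]) fun j hj => by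
    have : j ≠ k := fun h => hkP (h ▸ hj)
    simp [this]

theorem pathFactor_update_add (φ : ι → E →L[ℝ] ℂ) {o : ι} (i : ι) {P : List ι}
    (hP : (o :: P).Nodup) {k : ι} (hk : k ∈ o :: P) (v : ι → E) (x y : E) :
    pathFactor φ o i P (Function.update v k (x + y)) =
      pathFactor φ o i P (Function.update v k x) + pathFactor φ o i P (Function.update v k y) := by
  induction P generalizing v k x y with
  | nil =>
    simp only [List.mem_cons, List.not_mem_nil, or_false] at hk
    simp [pathFactor, hk]
  | cons j P ih =>
    simp only [List.nodup_cons, List.mem_cons, not_or] at hP ih hk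
    simp only [pathFactor]
    rw [← Finset.sum_add_distrib]
    refine Finset.sum_congr rfl fun m hm => ?_
    simp only [Finset.mem_insert, List.mem_toFinset] at hm
    have hmj : m ≠ j := by rintro rfl; tauto
    by_cases hkj : k = j
    · subst hkj
      simp only [Function.update_self, Function.update_of_ne hmj]
      have e : ∀ x y, pathFactor φ o i P (Function.update (Function.update v k x) m y) =
          pathFactor φ o i P (Function.update v m y) := fun x y => by
        rw [Function.update_comm hmj.symm]
        exact pathFactor_update φ (by tauto) (by tauto) _ _
      rw [e, e, e, ih (by tauto) hm, mul_add]
    · by_cases hkm : k = m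
      · subst hkm
        simp [Function.update_of_ne (Ne.symm hkj), add_mul]
      · simp only [Function.update_of_ne (Ne.symm hkj), Function.update_of_ne (Ne.symm hkm)]
        simp only [Function.update_comm hkm]
        rw [ih (by tauto) (by tauto), mul_add]

/-- All ways to split a list into two complementary sublists. -/
def splits : List ι → List (List ι × List ι)
  | [] => [([], [])]
  | j :: l => (splits l).map (fun p => (p.1, j :: p.2)) ++ (splits l).map (fun p => (j :: p.1, p.2))

omit [DecidableEq ι] in
theorem perm_of_mem_splits {l : List ι} {p : List ι × List ι} (hp : p ∈ splits l) :
    l.Perm (p.1 ++ p.2) := by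
  induction l generalizing p with
  | nil => simp [splits] at hp; simp [hp]
  | cons j l ih =>
    simp only [splits, List.mem_append, List.mem_map] at hp
    rcases hp with ⟨q, hq, rfl⟩ | ⟨q, hq, rfl⟩
    · exact ((ih hq).cons j).trans List.perm_middle.symm
    · exact (ih hq).cons j

theorem shiftDeriv_congr_of_forall (φ : ι → E →L[ℝ] ℂ) (s : Finset ι) (j : ι)
    {f g : (ι → E) → F} (h : ∀ v, f v = g v) (v : ι → E) :
    shiftDeriv φ s j f v = shiftDeriv φ s j g v := by
  rw [funext h]

theorem shiftDeriv_sub (φ : ι → E →L[ℝ] ℂ) (s : Finset ι) (j : ι)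
    (f g : (ι → E) → F) (v : ι → E) :
    shiftDeriv φ s j (fun w => f w - g w) v = shiftDeriv φ s j f v - shiftDeriv φ s j g v := by
  simp only [shiftDeriv]
  rw [← Finset.sum_sub_distrib]
  refine Finset.sum_congr rfl fun k _ => ?_
  rw [← smul_sub]
  congr 1
  abel

theorem shiftDeriv_listSum {α : Type*} (φ : ι → E →L[ℝ] ℂ) (s : Finset ι) (j : ι)
    (L : List α) (f : α → (ι → E) → F) (v : ι → E) :
    shiftDeriv φ s j (fun w => (L.map fun p => f p w).sum) v =
      (L.map fun p => shiftDeriv φ s j (f p) v).sum := by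
  induction L with
  | nil => simp [shiftDeriv]
  | cons p L ih =>
    rw [List.map_cons, List.sum_cons, ← ih]
    simp only [List.map_cons, List.sum_cons, shiftDeriv]
    rw [← Finset.sum_add_distrib]
    refine Finset.sum_congr rfl fun k _ => ?_
    rw [← smul_add]
    congr 1
    abel

/-- The product of a path factor and of an iterated symbol whose base variable absorbs the path. -/
def splitTerm (φ : ι → E →L[ℝ] ℂ) (o i : ι) (a : E → F) (p : List ι × List ι) (v : ι → E) : F :=
  pathFactor φ o i p.1 v •
    iterSymbol φ o a p.2 (v + Pi.single o (v i + ∑ k ∈ p.1.toFinset, v k))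

theorem shiftDeriv_splitTerm (φ : ι → E →L[ℝ] ℂ) {o i j : ι} (a : E → F) {P l : List ι}
    (h : (o :: i :: j :: (P ++ l)).Nodup) (v : ι → E) :
    shiftDeriv φ (insert o (insert i (P ++ l).toFinset)) j (splitTerm φ o i a (P, l)) v =
      splitTerm φ o i a (P, j :: l) v + splitTerm φ o i a (j :: P, l) v := by
  simp only [List.nodup_cons, List.mem_cons, not_or, List.mem_append, List.nodup_append] at h
  obtain ⟨⟨hoi, hoj, hoP, hol⟩, ⟨hij, hiP, hil⟩, ⟨hjP, hjl⟩, hP, hl, hPl⟩ := h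
  have hdisj : Disjoint (insert i (insert o P.toFinset)) l.toFinset := by
    rw [Finset.disjoint_left]
    intro k hk hk'
    simp only [Finset.mem_insert, List.mem_toFinset] at hk hk'
    rcases hk with rfl | rfl | hk
    · exact hil hk'
    · exact hol hk'
    · exact hPl k hk k hk' rfl
  have hset : insert o (insert i (P ++ l).toFinset) =
      (insert i (insert o P.toFinset)) ∪ l.toFinset := by
    ext k; simp; tauto
  have hi' : i ∉ insert o P.toFinset := by simp [Ne.symm hoi, hiP]
  have ho' : o ∉ P.toFinset := by simp [hoP]
  have ho'' : o ∉ l.toFinset := by simp [hol]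
  set c : E := v i + ∑ k ∈ P.toFinset, v k with hc
  set M := pathFactor φ o i P v with hM
  set h1 := iterSymbol φ o a l (v + Pi.single o (c + v j)) with hh1
  set h0 := iterSymbol φ o a l (v + Pi.single o c) with hh0
  have key1 : ∀ k ∈ insert o P.toFinset, splitTerm φ o i a (P, l) (v + Pi.single k (v j)) =
      (M + pathFactor φ o i P (Function.update v k (v j))) • h1 := by
    intro k hk
    have hki : i ≠ k := fun h => hi' (h ▸ hk)
    simp only [splitTerm]
    congr 1
    · have : v + Pi.single k (v j) = Function.update v k (v k + v j) := by
        ext m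
        by_cases hm : m = k
        · subst hm; simp
        · simp [hm]
      rw [this, pathFactor_update_add φ i (by simp [hoP, hP]) (by simpa using hk),
        Function.update_eq_self]
    · apply iterSymbol_congr
      · simp only [Pi.add_apply, Pi.single_eq_same, Finset.sum_add_distrib, hc,
          Pi.single_eq_of_ne hki]
        rcases Finset.mem_insert.1 hk with rfl | hk'
        · rw [Finset.sum_eq_zero (s := P.toFinset) (f := fun x => (Pi.single k (v j) : ι → E) x)]
          · simp; abel
          · intro m hm
            have : m ≠ k := fun h => ho' (h ▸ hm)
            simp [this]
        · have : o ≠ k := fun h => ho' (h ▸ hk')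
          have hs : ∑ m ∈ P.toFinset, (Pi.single k (v j) : ι → E) m = v j := by
            rw [Finset.sum_eq_single_of_mem k hk']
            · simp
            · intro m _ hm
              simp [hm]
          simp only [hs, Pi.single_eq_of_ne this]
          abel
      · intro m hm
        have hmo : m ≠ o := fun h => hol (h ▸ hm)
        have hmk : m ≠ k := by
          rintro rfl
          simp only [Finset.mem_insert, List.mem_toFinset] at hk
          rcases hk with rfl | hk
          · exact hmo rfl
          · exact hPl m hk m hm rfl
        simp [hmo, hmk]
  have key2 : splitTerm φ o i a (P, l) (v + Pi.single i (v j)) = M • h1 := by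
    simp only [splitTerm]
    congr 1
    · apply pathFactor_congr
      · simp [hoi]
      · intro m hm
        have : m ≠ i := fun h => hiP (h ▸ hm)
        simp [this]
    · apply iterSymbol_congr
      · have : ∑ k ∈ P.toFinset, (v + (Pi.single i (v j) : ι → E)) k = ∑ k ∈ P.toFinset, v k := by
          refine Finset.sum_congr rfl fun m hm => ?_
          have : m ≠ i := fun h => hiP (h ▸ by simpa using hm)
          simp [this]
        rw [Pi.add_apply, this]
        simp [hoi, hc]; abel
      · intro m hm
        have hmo : m ≠ o := fun h => hol (h ▸ hm)
        have hmi : m ≠ i := fun h => hil (h ▸ hm)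
        simp [hmo, hmi]
  have key3 : ∀ k ∈ l.toFinset, splitTerm φ o i a (P, l) (v + Pi.single k (v j)) =
      M • iterSymbol φ o a l (v + Pi.single o c + Pi.single k (v j)) := by
    intro k hk
    have hkl : k ∈ l := by simpa using hk
    have hko : o ≠ k := fun h => hol (h ▸ hkl)
    have hki : i ≠ k := fun h => hil (h ▸ hkl)
    have hkP : ∀ m ∈ P, m ≠ k := fun m hm h => hPl m hm k hkl h
    simp only [splitTerm]
    congr 1
    · apply pathFactor_congr
      · simp [hko]
      · intro m hm
        simp [hkP m hm]
    · have : ∑ k' ∈ P.toFinset, (v + (Pi.single k (v j) : ι → E)) k' = ∑ k ∈ P.toFinset, v k := by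
        refine Finset.sum_congr rfl fun m hm => ?_
        simp [hkP m (by simpa using hm)]
      rw [this, Pi.add_apply, Pi.single_eq_of_ne hki, add_zero, add_right_comm]
  have key0 : splitTerm φ o i a (P, l) v = M • h0 := rfl
  have rhs1 : splitTerm φ o i a (P, j :: l) v =
      M • (φ j (v o + c) • (h1 - h0) + ∑ k ∈ l.toFinset, φ j (v k) •
        (iterSymbol φ o a l (v + Pi.single o c + Pi.single k (v j)) - h0)) := by
    simp only [splitTerm, iterSymbol, shiftDeriv]
    rw [Finset.sum_insert ho'']
    have e1 : (v + (Pi.single o c : ι → E)) j = v j := by simp [Ne.symm hoj]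
    simp only [← hc, e1, ← hM, ← hh0]
    congr 2
    · rw [add_assoc, ← Pi.single_add, ← hh1]; simp
    · refine Finset.sum_congr rfl fun k hk => ?_
      have hko : k ≠ o := fun h => ho'' (h ▸ hk)
      simp [hko]
  have rhs2 : splitTerm φ o i a (j :: P, l) v =
      ∑ k ∈ insert o P.toFinset, (φ j (v k) * pathFactor φ o i P (Function.update v k (v j))) • h1 := by
    simp only [splitTerm, pathFactor, List.toFinset_cons]
    rw [Finset.sum_insert (a := j) (by simpa using hjP), Finset.sum_smul]
    have : v i + (v j + ∑ k ∈ P.toFinset, v k) = c + v j := by rw [hc]; abel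
    simp only [this, ← hh1]
  rw [rhs1, rhs2, hset, shiftDeriv, Finset.sum_union hdisj, Finset.sum_insert hi',
    Finset.sum_congr rfl fun k hk => by rw [key1 k hk, key0],
    Finset.sum_congr (s₁ := l.toFinset) rfl fun k hk => by rw [key3 k hk, key0], key2, key0]
  have hsum : φ j (v o + c) = φ j (v i) + ∑ k ∈ insert o P.toFinset, φ j (v k) := by
    rw [Finset.sum_insert ho', hc, map_add, map_add, map_sum]; ring
  rw [hsum, add_smul, Finset.sum_smul, smul_add, smul_add, Finset.smul_sum, Finset.smul_sum]
  have e2 : ∀ k, φ j (v k) • ((M + pathFactor φ o i P (Function.update v k (v j))) • h1 - M • h0) =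
      M • φ j (v k) • (h1 - h0) +
        (φ j (v k) * pathFactor φ o i P (Function.update v k (v j))) • h1 := by
    intro k; module
  simp only [e2, Finset.sum_add_distrib, ← smul_sub]
  simp only [smul_comm M]
  abel

theorem iterSymbol_append_singleton (φ : ι → E →L[ℝ] ℂ) {o i : ι} (a : E → F) {l : List ι}
    (h : (o :: i :: l).Nodup) (v : ι → E) :
    iterSymbol φ o a (l ++ [i]) v = ((splits l).map fun p => splitTerm φ o i a p v).sum -
      iterSymbol φ o (fun ζ => φ i ζ • a ζ) l v := by
  induction l generalizing v with
  | nil =>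
    simp only [List.nodup_cons, List.mem_cons, List.not_mem_nil, or_false] at h
    simp [splits, iterSymbol, shiftDeriv, splitTerm, pathFactor, smul_sub]
  | cons j l ih =>
    have h' : (o :: i :: l).Nodup := by
      simp only [List.nodup_cons, List.mem_cons, not_or] at h ⊢; tauto
    rw [List.cons_append, iterSymbol, shiftDeriv_congr_of_forall φ _ j (ih h'),
      shiftDeriv_sub, shiftDeriv_listSum]
    congr 1
    · simp only [splits, List.map_append, List.sum_append, List.map_map, ← List.sum_map_add]
      congr 1
      refine List.map_congr_left fun p hp => ?_
      obtain ⟨P, l'⟩ := p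
      have hperm := perm_of_mem_splits hp
      have hset : insert o (l ++ [i]).toFinset = insert o (insert i (P ++ l').toFinset) := by
        rw [← List.toFinset_eq_of_perm _ _ hperm]
        ext k; simp
      rw [hset]
      exact shiftDeriv_splitTerm φ a ((((hperm.cons j).cons i).cons o).nodup_iff.1 h) v
    · simp only [List.nodup_cons, List.mem_cons, not_or] at h
      have hset : insert o (l ++ [i]).toFinset = insert i (insert o l.toFinset) := by
        ext k; simp; tauto
      rw [hset, iterSymbol, shiftDeriv, Finset.sum_insert, iterSymbol_add_single]
      · simp [shiftDeriv]
      · tauto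
      · tauto
      · simp only [Finset.mem_insert, List.mem_toFinset]; tauto

end IteratedCommutator

section Bracket

variable {E : Type*} [NormedAddCommGroup E]

/-- The bracket `(1 + ‖x‖²)^{1/2}`. -/
def bracket (x : E) : ℝ := √(1 + ‖x‖ ^ 2)

theorem one_le_bracket (x : E) : 1 ≤ bracket x := by
  rw [bracket, Real.one_le_sqrt]
  nlinarith [sq_nonneg ‖x‖]

theorem bracket_pos (x : E) : 0 < bracket x := one_pos.trans_le (one_le_bracket x)

theorem bracket_sq (x : E) : bracket x ^ 2 = 1 + ‖x‖ ^ 2 := Real.sq_sqrt (by positivity)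

theorem norm_le_bracket (x : E) : ‖x‖ ≤ bracket x :=
  Real.le_sqrt_of_sq_le (by linarith)

theorem bracket_add_le (x y : E) : bracket (x + y) ≤ bracket x + ‖y‖ := by
  refine Real.sqrt_le_iff.2 ⟨by have := bracket_pos x; positivity, ?_⟩
  have h1 := norm_add_le x y
  have h2 := bracket_sq x
  have h3 := norm_le_bracket x
  nlinarith [norm_nonneg (x + y), norm_nonneg y, norm_nonneg x,
    mul_le_mul_of_nonneg_right h3 (norm_nonneg y)]

theorem rpow_le_rpow_of_comparable {A B c : ℝ} (hA : 0 < A) (hB : 0 < B) (hc : 1 ≤ c)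
    (h1 : A ≤ c * B) (h2 : B ≤ c * A) (s : ℝ) : A ^ s ≤ c ^ |s| * B ^ s := by
  have hc0 : 0 < c := one_pos.trans_le hc
  rcases le_total 0 s with hs | hs
  · rw [abs_of_nonneg hs, ← Real.mul_rpow hc0.le hB.le]
    exact Real.rpow_le_rpow hA.le h1 hs
  · rw [abs_of_nonpos hs, Real.rpow_neg hc0.le, ← Real.inv_rpow hc0.le,
      ← Real.mul_rpow (by positivity) hB.le]
    refine Real.rpow_le_rpow_of_nonpos (by positivity) ?_ hs
    rw [inv_mul_le_iff₀ hc0]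
    exact h2

end Bracket

section SymbolClass

open scoped ContDiff

variable {P V V' F : Type*} [NormedAddCommGroup V] [NormedSpace ℝ V]
  [NormedAddCommGroup V'] [NormedSpace ℝ V'] [NormedAddCommGroup F] [NormedSpace ℂ F]

/-- A family `f p` of smooth functions which are symbols of order `s` on the set `Γ`, relative to
the size function `ρ`, with constants proportional to the weight `W p`. -/
def IsSymbolOn (Γ : Set V) (ρ : V → ℝ) (s : ℝ) (W : P → ℝ) (f : P → V → F) : Prop :=
  (∀ p, ContDiff ℝ ∞ (f p)) ∧ ∀ m : ℕ, ∃ C : ℝ, 0 ≤ C ∧ ∀ p, ∀ v ∈ Γ,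
    ‖iteratedFDeriv ℝ m (f p) v‖ ≤ C * W p * ρ v ^ (s - m)

namespace IsSymbolOn

variable {Γ : Set V} {ρ : V → ℝ} {s t : ℝ} {W w : P → ℝ} {f g : P → V → F}

theorem mono {Γ' : Set V} (hf : IsSymbolOn Γ ρ s W f) (h : Γ' ⊆ Γ) : IsSymbolOn Γ' ρ s W f :=
  ⟨hf.1, fun m => (hf.2 m).imp fun _ hC => ⟨hC.1, fun p v hv => hC.2 p v (h hv)⟩⟩

theorem zero : IsSymbolOn Γ ρ s W (fun _ _ => (0 : F)) := by
  refine ⟨fun p => contDiff_const, fun m => ⟨0, le_rfl, fun p v hv => ?_⟩⟩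
  have : iteratedFDeriv ℝ m (fun _ : V => (0 : F)) v = 0 := by
    exact congrFun iteratedFDeriv_fun_zero v
  simp [this]

theorem add (hf : IsSymbolOn Γ ρ s W f) (hg : IsSymbolOn Γ ρ s W g) :
    IsSymbolOn Γ ρ s W (fun p v => f p v + g p v) := by
  refine ⟨fun p => (hf.1 p).add (hg.1 p), fun m => ?_⟩
  obtain ⟨C, hC, hfC⟩ := hf.2 m
  obtain ⟨D, hD, hgD⟩ := hg.2 m
  refine ⟨C + D, by positivity, fun p v hv => ?_⟩
  have hm : (m : WithTop ℕ∞) ≤ ∞ := by exact_mod_cast le_top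
  rw [fun_iteratedFDeriv_add_apply ((hf.1 p).of_le hm).contDiffAt ((hg.1 p).of_le hm).contDiffAt]
  calc _ ≤ _ := norm_add_le _ _
    _ ≤ C * W p * ρ v ^ (s - m) + D * W p * ρ v ^ (s - m) := add_le_add (hfC p v hv) (hgD p v hv)
    _ = _ := by ring

theorem sum {α : Type*} (S : Finset α) {f : α → P → V → F}
    (hf : ∀ k ∈ S, IsSymbolOn Γ ρ s W (f k)) :
    IsSymbolOn Γ ρ s W (fun p v => ∑ k ∈ S, f k p v) := by
  classical
  induction S using Finset.induction_on with
  | empty => simpa using zero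
  | insert k S hk ih =>
    simp only [Finset.sum_insert hk]
    exact (hf k (by simp)).add (ih fun m hm => hf m (by simp [hm]))

theorem sub (hf : IsSymbolOn Γ ρ s W f) (hg : IsSymbolOn Γ ρ s W g) :
    IsSymbolOn Γ ρ s W (fun p v => f p v - g p v) := by
  have hg' : IsSymbolOn Γ ρ s W (fun p v => - g p v) := by
    refine ⟨fun p => (hg.1 p).neg, fun m => (hg.2 m).imp fun C hC => ⟨hC.1, fun p v hv => ?_⟩⟩
    have := iteratedFDeriv_neg_apply (𝕜 := ℝ) (i := m) (f := g p) (x := v)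
    change ‖iteratedFDeriv ℝ m (-g p) v‖ ≤ _
    rw [this, norm_neg]
    exact hC.2 p v hv
  simpa only [sub_eq_add_neg] using hf.add hg'

theorem smul {g : P → V → ℂ} (hρ : ∀ v ∈ Γ, 0 < ρ v) (hg : IsSymbolOn Γ ρ t w g)
    (hf : IsSymbolOn Γ ρ s W f) :
    IsSymbolOn Γ ρ (t + s) (fun p => w p * W p) (fun p v => g p v • f p v) := by
  refine ⟨fun p => (hg.1 p).smul (hf.1 p), fun m => ?_⟩
  choose C hC hfC using hf.2
  choose D hD hgD using hg.2
  refine ⟨∑ i ∈ Finset.range (m + 1), m.choose i * D i * C (m - i),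
    Finset.sum_nonneg fun i _ => mul_nonneg (mul_nonneg (by positivity) (hD i)) (hC _),
    fun p v hv => ?_⟩
  have hm : (m : WithTop ℕ∞) ≤ ∞ := by exact_mod_cast le_top
  refine (norm_iteratedFDeriv_smul_le ((hg.1 p)) ((hf.1 p)) v hm).trans ?_
  rw [Finset.sum_mul, Finset.sum_mul]
  refine Finset.sum_le_sum fun i hi => ?_
  have him : i ≤ m := by simpa [Nat.lt_succ_iff] using hi
  calc (m.choose i : ℝ) * ‖iteratedFDeriv ℝ i (g p) v‖ * ‖iteratedFDeriv ℝ (m - i) (f p) v‖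
      ≤ (m.choose i : ℝ) * (D i * w p * ρ v ^ (t - i)) *
        (C (m - i) * W p * ρ v ^ (s - (m - i : ℕ))) := by
        have h1 := hgD i p v hv
        have h2 := hfC (m - i) p v hv
        have h3 := (norm_nonneg _).trans h1
        gcongr
    _ = m.choose i * D i * C (m - i) * (w p * W p) *
        (ρ v ^ (t - i) * ρ v ^ (s - (m - i : ℕ))) := by ring
    _ = _ := by
        rw [← Real.rpow_add (hρ v hv), Nat.cast_sub him]
        congr 2
        ring

theorem of_linear {L : P → V →L[ℝ] ℂ} {c : ℝ} (hc : 0 ≤ c)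
    (hL : ∀ p, ‖L p‖ ≤ w p) (hLρ : ∀ p, ∀ v ∈ Γ, ‖L p v‖ ≤ c * w p * ρ v) :
    IsSymbolOn Γ ρ 1 w (fun p v => L p v) := by
  refine ⟨fun p => (L p).contDiff, fun m => ?_⟩
  match m with
  | 0 => exact ⟨c, hc, fun p v hv => by simpa using hLρ p v hv⟩
  | 1 =>
    refine ⟨1, zero_le_one, fun p v hv => ?_⟩
    rw [norm_iteratedFDeriv_one, (L p).fderiv]
    simpa using hL p
  | m + 2 =>
    refine ⟨0, le_rfl, fun p v hv => ?_⟩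
    rw [← norm_iteratedFDeriv_fderiv]
    have : fderiv ℝ (fun v => L p v) = fun _ => L p := by
      ext1 v; exact (L p).fderiv
    rw [this, iteratedFDeriv_const_of_ne (by omega)]
    simp

theorem comp_clm {Γ' : Set V'} {ρ' : V' → ℝ} {f : P → V' → F} (hf : IsSymbolOn Γ' ρ' s W f)
    (hW : ∀ p, 0 ≤ W p) (hρ : ∀ v ∈ Γ, 0 < ρ v) (hρ' : ∀ v ∈ Γ', 0 < ρ' v) (T : V →L[ℝ] V')
    (hT : Set.MapsTo T Γ Γ') {c : ℝ}
    (hc : 1 ≤ c) (h1 : ∀ v ∈ Γ, ρ' (T v) ≤ c * ρ v) (h2 : ∀ v ∈ Γ, ρ v ≤ c * ρ' (T v)) :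
    IsSymbolOn Γ ρ s W (fun p v => f p (T v)) := by
  refine ⟨fun p => (hf.1 p).comp T.contDiff, fun m => ?_⟩
  obtain ⟨C, hC, hfC⟩ := hf.2 m
  refine ⟨C * c ^ |s - m| * ‖T‖ ^ m, by positivity, fun p v hv => ?_⟩
  have hm : (m : WithTop ℕ∞) ≤ ∞ := by exact_mod_cast le_top
  have := T.iteratedFDeriv_comp_right (hf.1 p) v hm
  change ‖iteratedFDeriv ℝ m (f p ∘ T) v‖ ≤ _
  rw [this]
  refine (ContinuousMultilinearMap.norm_compContinuousLinearMap_le _ _).trans ?_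
  rw [Finset.prod_const, Finset.card_univ, Fintype.card_fin]
  calc _ ≤ C * W p * (c ^ |s - m| * ρ v ^ (s - m)) * ‖T‖ ^ m := by
        have h3 := hfC p (T v) (hT hv)
        have h4 := rpow_le_rpow_of_comparable (hρ' _ (hT hv)) (hρ v hv) hc (h1 v hv) (h2 v hv)
          (s - m)
        have := hW p
        refine mul_le_mul_of_nonneg_right (h3.trans ?_) (by positivity)
        exact mul_le_mul_of_nonneg_left h4 (by positivity)
    _ = _ := by ring

end IsSymbolOn

end SymbolClass

section Vanishing

open scoped ContDiff

variable {ι E F : Type*} [Fintype ι] [DecidableEq ι] [NormedAddCommGroup E] [NormedSpace ℝ E]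
  [NormedAddCommGroup F] [NormedSpace ℝ F]

theorem norm_le_prod_of_vanishing {Ω : Set (ι → E)} {l : List ι} (hl : l.Nodup)
    (hΩ : ∀ w ∈ Ω, ∀ j ∈ l, ∀ t ∈ Set.Icc (0 : ℝ) 1, Function.update w j (t • w j) ∈ Ω)
    {f : (ι → E) → F} (hf : ContDiff ℝ ∞ f) (h0 : ∀ j ∈ l, ∀ w, w j = 0 → f w = 0) {K : ℝ}
    (hK : ∀ w ∈ Ω, ‖iteratedFDeriv ℝ l.length f w‖ ≤ K) {w : ι → E} (hw : w ∈ Ω) :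
    ‖f w‖ ≤ K * (l.map fun j => ‖w j‖).prod := by
  induction l generalizing f K w with
  | nil => simpa using hK w hw
  | cons j l ih =>
    have hjl : j ∉ l := (List.nodup_cons.1 hl).1
    set u : E := w j with hu
    set f' : (ι → E) → F := fun v => fderiv ℝ f v (Pi.single j u) with hf'
    have hfd : ContDiff ℝ ∞ (fderiv ℝ f) := hf.fderiv_right (by simp)
    have hf'c : ContDiff ℝ ∞ f' := hfd.clm_apply contDiff_const
    have hdiff : Differentiable ℝ f := hf.differentiable (by simp)
    have h0' : ∀ i ∈ l, ∀ v, v i = 0 → f' v = 0 := by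
      intro i hi v hv
      have hij : i ≠ j := fun h => hjl (h ▸ hi)
      have h1 : HasDerivAt (fun t : ℝ => f (v + t • (Pi.single j u : ι → E))) (f' v) 0 := by
        have h2 : HasDerivAt (fun t : ℝ => v + t • (Pi.single j u : ι → E)) (Pi.single j u) 0 := by
          simpa using ((hasDerivAt_id (0 : ℝ)).smul_const (Pi.single j u : ι → E)).const_add v
        have h3 : HasFDerivAt f (fderiv ℝ f v) (v + (0 : ℝ) • (Pi.single j u : ι → E)) := by
          simpa using (hdiff v).hasFDerivAt
        exact h3.comp_hasDerivAt 0 h2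
      have h4 : (fun t : ℝ => f (v + t • (Pi.single j u : ι → E))) = fun _ => 0 := by
        ext1 t
        exact h0 i (by simp [hi]) _ (by simp [hv, hij])
      rw [h4] at h1
      exact h1.unique (hasDerivAt_const _ _)
    have hK' : ∀ v ∈ Ω, ‖iteratedFDeriv ℝ l.length f' v‖ ≤ K * ‖u‖ := by
      intro v hv
      have h1 := norm_iteratedFDeriv_clm_apply_const (c := (Pi.single j u : ι → E)) (N := ∞)
        (n := l.length) (hfd.contDiffAt (x := v)) (by exact_mod_cast le_top)
      rw [norm_iteratedFDeriv_fderiv, Pi.norm_single] at h1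
      refine h1.trans ?_
      rw [mul_comm]
      exact mul_le_mul_of_nonneg_right (hK v hv) (norm_nonneg _)
    have key : ∀ t ∈ Set.Icc (0 : ℝ) 1, ‖f' (Function.update w j (t • w j))‖ ≤
        K * ‖u‖ * (l.map fun j => ‖w j‖).prod := by
      intro t ht
      refine (ih (List.nodup_cons.1 hl).2 (fun v hv i hi => hΩ v hv i (by simp [hi])) hf'c h0' hK'
        (hΩ w hw j (by simp) t ht)).trans_eq ?_
      congr 2
      refine List.map_congr_left fun i hi => ?_
      have hij : i ≠ j := fun h => hjl (h ▸ hi)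
      simp [hij]
    have hline : ∀ t : ℝ, Function.update w j (t • w j) =
        Function.update w j 0 + t • (Pi.single j u : ι → E) := by
      intro t
      ext i
      by_cases hi : i = j
      · subst hi; simp [hu]
      · simp [hi]
    have hder : ∀ t : ℝ, HasDerivAt (fun t : ℝ => f (Function.update w j (t • w j)))
        (f' (Function.update w j (t • w j))) t := by
      intro t
      have h2 : HasDerivAt (fun t : ℝ => Function.update w j (t • w j)) (Pi.single j u) t := by
        simp only [hline]
        simpa using ((hasDerivAt_id t).smul_const (Pi.single j u : ι → E)).const_add
          (Function.update w j 0)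
      exact (hdiff _).hasFDerivAt.comp_hasDerivAt t h2
    have hmv := norm_image_sub_le_of_norm_deriv_le_segment_01'
      (fun t _ => (hder t).hasDerivWithinAt) (fun t ht => key t ⟨ht.1, ht.2.le⟩)
    have e1 : f (Function.update w j ((0 : ℝ) • w j)) = 0 := h0 j (by simp) _ (by simp)
    rw [e1, one_smul, Function.update_eq_self, sub_zero] at hmv
    refine hmv.trans_eq ?_
    simp [← hu, mul_assoc]

end Vanishing

section EasyRegion

variable {P ι E F : Type*} [Fintype ι] [DecidableEq ι] [NormedAddCommGroup E] [NormedSpace ℝ E]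
  [NormedAddCommGroup F] [NormedSpace ℂ F]

/-- The region where every variable is small relative to the base variable. -/
def smallRegion (o : ι) (ε : ℝ) : Set (ι → E) :=
  {v | ∀ j, j ≠ o → ‖v j‖ ≤ ε * bracket (v o)}

omit [Fintype ι] [NormedSpace ℝ E] in
theorem smallRegion_add_single {o : ι} {ε : ℝ} (hε : 0 < ε) (hε1 : ε ≤ 1) {j k : ι} (hj : j ≠ o)
    {v : ι → E} (hv : v ∈ smallRegion o (ε / 2)) :
    v + Pi.single k (v j) ∈ smallRegion o ε ∧
      bracket ((v + (Pi.single k (v j) : ι → E)) o) ≤ 2 * bracket (v o) ∧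
      bracket (v o) ≤ 2 * bracket ((v + (Pi.single k (v j) : ι → E)) o) := by
  have hjv := hv j hj
  have hb := bracket_pos (v o)
  have hεb : ε * bracket (v o) ≤ bracket (v o) := by nlinarith
  by_cases hk : k = o
  · subst hk
    have h1 := bracket_add_le (v k) (v j)
    have h2 : bracket (v k) ≤ bracket (v k + v j) + ‖v j‖ := by
      simpa using bracket_add_le (v k + v j) (- v j)
    have h3 : bracket (v k) ≤ 2 * bracket (v k + v j) := by linarith
    refine ⟨fun m hm => ?_, ?_, ?_⟩
    · have := hv m hm
      simp only [Pi.add_apply, Pi.single_eq_same, Pi.single_eq_of_ne hm, add_zero]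
      nlinarith
    · simp only [Pi.add_apply, Pi.single_eq_same]; linarith
    · simpa using h3
  · have hko : o ≠ k := Ne.symm hk
    refine ⟨fun m hm => ?_, ?_, ?_⟩
    · have h1 := hv m hm
      by_cases hmk : m = k
      · subst hmk
        simp only [Pi.add_apply, Pi.single_eq_same, Pi.single_eq_of_ne hko, add_zero]
        have := norm_add_le (v m) (v j)
        linarith
      · simp only [Pi.add_apply, Pi.single_eq_of_ne hmk, Pi.single_eq_of_ne hko, add_zero]
        nlinarith
    · simp only [Pi.add_apply, Pi.single_eq_of_ne hko, add_zero]; linarith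
    · simp only [Pi.add_apply, Pi.single_eq_of_ne hko, add_zero]; linarith

theorem isSymbolOn_iterSymbol {s : ℝ} {W : P → ℝ} (hW : ∀ p, 0 ≤ W p) {a : P → E → F}
    (ha : IsSymbolOn Set.univ bracket s W a) (φ : P → ι → E →L[ℝ] ℂ) {o : ι} {l : List ι}
    (hl : (o :: l).Nodup) :
    ∃ ε : ℝ, 0 < ε ∧ ε ≤ 1 ∧ IsSymbolOn (smallRegion o ε) (fun v => bracket (v o))
      (s + l.length) (fun p => (l.map fun j => ‖φ p j‖).prod * W p)
      (fun p => iterSymbol (φ p) o (a p) l) := by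
  have hpos : ∀ ε : ℝ, ∀ v ∈ smallRegion (E := E) o ε, 0 < bracket (v o) :=
    fun ε v _ => bracket_pos _
  induction l with
  | nil =>
    refine ⟨1, one_pos, le_rfl, ?_⟩
    have := ha.comp_clm (Γ := smallRegion o 1) (ρ := fun v => bracket (v o)) hW (hpos 1)
      (fun _ _ => bracket_pos _) (ContinuousLinearMap.proj o) (Set.mapsTo_univ _ _)
      (c := 1) le_rfl (by simp) (by simp)
    convert this using 1
    · simp
    · simp
    · rfl
  | cons j l ih =>
    have hl' : (o :: l).Nodup := by
      simp only [List.nodup_cons, List.mem_cons, not_or] at hl ⊢; tauto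
    have hjo : j ≠ o := by
      simp only [List.nodup_cons, List.mem_cons, not_or] at hl; tauto
    obtain ⟨ε, hε, hε1, h⟩ := ih hl'
    have hW' : ∀ p, 0 ≤ (l.map fun j => ‖φ p j‖).prod * W p := fun p =>
      mul_nonneg (List.prod_nonneg (by simp)) (hW p)
    refine ⟨ε / 2, by positivity, by linarith, ?_⟩
    have hsub : smallRegion (E := E) o (ε / 2) ⊆ smallRegion o ε := fun v hv m hm =>
      (hv m hm).trans (by have := bracket_pos (v o); gcongr; linarith)
    have hmain : ∀ k ∈ insert o l.toFinset, IsSymbolOn (smallRegion o (ε / 2))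
        (fun v => bracket (v o)) (1 + (s + l.length))
        (fun p => ‖φ p j‖ * ((l.map fun j => ‖φ p j‖).prod * W p))
        (fun p v => φ p j (v k) • (iterSymbol (φ p) o (a p) l (v + Pi.single k (v j)) -
          iterSymbol (φ p) o (a p) l v)) := by
      intro k _
      refine IsSymbolOn.smul (hpos _) ?_ (IsSymbolOn.sub ?_ (h.mono hsub))
      · refine IsSymbolOn.of_linear (c := 1)
          (L := fun p => (φ p j).comp (ContinuousLinearMap.proj (R := ℝ) (φ := fun _ : ι => E) k)) zero_le_one ?_ ?_
        · intro p
          refine ContinuousLinearMap.opNorm_le_bound _ (norm_nonneg _) fun v => ?_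
          exact ((φ p j).le_opNorm _).trans
            (mul_le_mul_of_nonneg_left (norm_le_pi_norm v k) (norm_nonneg _))
        · intro p v hv
          rw [one_mul]
          refine ((φ p j).le_opNorm _).trans (mul_le_mul_of_nonneg_left ?_ (norm_nonneg _))
          by_cases hk : k = o
          · subst hk; exact norm_le_bracket _
          · have := bracket_pos (v o)
            exact (hv k hk).trans (by nlinarith)
      · exact h.comp_clm hW' (hpos _) (hpos _)
          (ContinuousLinearMap.id ℝ (ι → E) +
            (ContinuousLinearMap.single ℝ (fun _ : ι => E) k).comp (ContinuousLinearMap.proj j))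
          (fun v hv => (smallRegion_add_single hε hε1 hjo hv).1) one_le_two
          (fun v hv => (smallRegion_add_single hε hε1 hjo hv).2.1)
          (fun v hv => (smallRegion_add_single hε hε1 hjo hv).2.2)
    have := IsSymbolOn.sum _ hmain
    convert this using 1
    · push_cast [List.length_cons]; ring
    · funext p; rw [List.map_cons, List.prod_cons, mul_assoc]
    · rfl

theorem norm_iterSymbol_le_of_small {s : ℝ} {W : P → ℝ} (hW : ∀ p, 0 ≤ W p) {a : P → E → F}
    (ha : IsSymbolOn Set.univ bracket s W a) (φ : P → ι → E →L[ℝ] ℂ) {o : ι} {l : List ι}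
    (hl : (o :: l).Nodup) :
    ∃ ε : ℝ, 0 < ε ∧ ∃ C : ℝ, 0 ≤ C ∧ ∀ p, ∀ v : ι → E,
      (∀ j ∈ l, ‖v j‖ ≤ ε * bracket (v o)) →
        ‖iterSymbol (φ p) o (a p) l v‖ ≤
          C * W p * (l.map fun j => ‖φ p j‖).prod * (l.map fun j => ‖v j‖).prod *
            bracket (v o) ^ s := by
  obtain ⟨ε, hε, -, h⟩ := isSymbolOn_iterSymbol hW ha φ hl
  obtain ⟨C, hC, hb⟩ := h.2 l.length
  refine ⟨ε, hε, C, hC, fun p v hv => ?_⟩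
  have hol : o ∉ l := (List.nodup_cons.1 hl).1
  set v' : ι → E := fun k => if k ∈ o :: l then v k else 0 with hv'
  have hvo : v' o = v o := by simp [hv']
  have hvl : ∀ j ∈ l, v' j = v j := fun j hj => by simp [hv', hj]
  rw [← iterSymbol_congr (φ p) o (a p) l hvo hvl]
  have hmem : v' ∈ {w | w ∈ smallRegion o ε ∧ w o = v o} := by
    refine ⟨fun j hj => ?_, hvo⟩
    rw [hvo]
    by_cases hjl : j ∈ l
    · rw [hvl j hjl]; exact hv j hjl
    · have := bracket_pos (v o)
      have : v' j = 0 := by simp [hv', hj, hjl]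
      rw [this, norm_zero]; positivity
  have := norm_le_prod_of_vanishing (Ω := {w | w ∈ smallRegion o ε ∧ w o = v o})
    (List.nodup_cons.1 hl).2 ?_ (h.1 p) (fun j hj w hw => iterSymbol_eq_zero (φ p) (a p) hl hj hw)
    (K := C * ((l.map fun j => ‖φ p j‖).prod * W p) * bracket (v o) ^ s) ?_ hmem
  · refine this.trans_eq ?_
    rw [List.map_congr_left (f := fun j => ‖v' j‖) (g := fun j => ‖v j‖)
      fun j hj => by rw [hvl j hj]]
    ring
  · rintro w ⟨hw, hwo⟩ j hj t ht
    have hjo : o ≠ j := fun h => hol (h ▸ hj)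
    refine ⟨fun m hm => ?_, by simp [hjo, hwo]⟩
    rw [Function.update_of_ne hjo]
    by_cases hmj : m = j
    · subst hmj
      rw [Function.update_self, norm_smul, Real.norm_of_nonneg ht.1]
      exact (mul_le_of_le_one_left (norm_nonneg _) ht.2).trans (hw m hm)
    · rw [Function.update_of_ne hmj]; exact hw m hm
  · rintro w ⟨hw, hwo⟩
    refine (hb p w hw).trans_eq ?_
    simp [hwo]

end EasyRegion

section PathFactorBound

variable {ι E : Type*} [DecidableEq ι] [NormedAddCommGroup E] [NormedSpace ℝ E]

theorem norm_pathFactor_le (φ : ι → E →L[ℝ] ℂ) (o i : ι) {P : List ι} (hP : (o :: P).Nodup)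
    (v : ι → E) :
    ‖pathFactor φ o i P v‖ ≤ (P.length.factorial : ℝ) *
      (‖φ i‖ * ∏ j ∈ P.toFinset, ‖φ j‖) * (‖v o‖ * ∏ j ∈ P.toFinset, ‖v j‖) := by
  induction P generalizing v with
  | nil => simpa [pathFactor] using (φ i).le_opNorm (v o)
  | cons j P ih =>
    simp only [List.nodup_cons, List.mem_cons, not_or] at hP ih
    have hjP : j ∉ P.toFinset := by simpa using hP.2.1
    have hoP : o ∉ P.toFinset := by simpa using hP.1.2
    have hcard : ((insert o P.toFinset).card : ℝ) ≤ P.length + 1 := by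
      rw [Finset.card_insert_of_notMem hoP]
      exact_mod_cast Nat.succ_le_succ P.toFinset_card_le
    rw [pathFactor]
    have hterm : ∀ k ∈ insert o P.toFinset,
        ‖φ j (v k) * pathFactor φ o i P (Function.update v k (v j))‖ ≤
        (P.length.factorial : ℝ) * (‖φ i‖ * (‖φ j‖ * ∏ j ∈ P.toFinset, ‖φ j‖)) *
          (‖v o‖ * (‖v j‖ * ∏ j ∈ P.toFinset, ‖v j‖)) := by
      intro k hk
      rw [norm_mul]
      have h1 := ih ⟨hP.1.2, hP.2.2⟩ (Function.update v k (v j))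
      have h2 : ‖v k‖ * (‖Function.update v k (v j) o‖ *
          ∏ m ∈ P.toFinset, ‖Function.update v k (v j) m‖) =
          ‖v o‖ * (‖v j‖ * ∏ m ∈ P.toFinset, ‖v m‖) := by
        rw [← Finset.prod_insert (f := fun m => ‖Function.update v k (v j) m‖) hoP,
          mul_left_comm, ← Finset.prod_insert (f := fun m => ‖v m‖) hoP,
          ← Finset.mul_prod_erase _ _ hk, ← Finset.mul_prod_erase _ (fun m => ‖v m‖) hk,
          Function.update_self, mul_left_comm]
        congr 2
        refine Finset.prod_congr rfl fun m hm => ?_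
        rw [Function.update_of_ne (Finset.ne_of_mem_erase hm)]
      calc _ ≤ (‖φ j‖ * ‖v k‖) * _ :=
            mul_le_mul ((φ j).le_opNorm _) h1 (norm_nonneg _) (by positivity)
        _ = (P.length.factorial : ℝ) * (‖φ i‖ * (‖φ j‖ * ∏ j ∈ P.toFinset, ‖φ j‖)) *
            (‖v k‖ * (‖Function.update v k (v j) o‖ *
              ∏ m ∈ P.toFinset, ‖Function.update v k (v j) m‖)) := by ring
        _ = _ := by rw [h2]
    refine (norm_sum_le_of_le _ hterm).trans ?_
    rw [Finset.sum_const, nsmul_eq_mul, List.toFinset_cons, Finset.prod_insert hjP,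
      Finset.prod_insert hjP, List.length_cons, Nat.factorial_succ]
    refine (mul_le_mul_of_nonneg_right hcard (by positivity)).trans_eq ?_
    push_cast
    ring

end PathFactorBound

section MainBound

variable {Q ι E F : Type*} [DecidableEq ι] [NormedAddCommGroup E] [NormedSpace ℝ E]
  [NormedAddCommGroup F] [NormedSpace ℂ F]

/-- The expected bound, up to a constant, of an iterated symbol of order `r` in the variables
of base index `o` and indices in `s`. -/
def symbolBound (φ : ι → E →L[ℝ] ℂ) (o : ι) (r : ℝ) (s : Finset ι) (v : ι → E) : ℝ :=
  (∏ j ∈ s, ‖φ j‖) * (bracket (v o) * ∏ j ∈ s, bracket (v j)) *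
    ∑ S ∈ s.powerset, bracket (v o + ∑ j ∈ S, v j) ^ (r - 1)

/-- The iterated symbols of a family are bounded by `symbolBound`. -/
def HasSymbolBound (φ : Q → ι → E →L[ℝ] ℂ) (o : ι) (r : ℝ) (W : Q → ℝ) (a : Q → E → F)
    (l : List ι) : Prop :=
  ∃ C : ℝ, 0 ≤ C ∧ ∀ p v,
    ‖iterSymbol (φ p) o (a p) l v‖ ≤ C * W p * symbolBound (φ p) o r l.toFinset v

omit [DecidableEq ι] [NormedSpace ℝ E] in
theorem prod_bracket_nonneg (s : Finset ι) (v : ι → E) : 0 ≤ ∏ j ∈ s, bracket (v j) :=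
  Finset.prod_nonneg fun j _ => (bracket_pos (v j)).le

omit [DecidableEq ι] [NormedSpace ℝ E] in
theorem bracket_add_sum_le {o i : ι} {ε : ℝ} (hε : 0 < ε) {v : ι → E}
    (hi : ε * bracket (v o) ≤ ‖v i‖) (S : Finset ι) (hS : ∀ j ∈ S, ‖v j‖ ≤ ‖v i‖) :
    bracket (v o + ∑ j ∈ S, v j) ≤ (ε⁻¹ + S.card) * bracket (v i) := by
  have h1 : ‖∑ j ∈ S, v j‖ ≤ S.card * ‖v i‖ := by
    simpa using norm_sum_le_of_le S hS
  have h2 : bracket (v o) ≤ ε⁻¹ * ‖v i‖ := by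
    rwa [← div_eq_inv_mul, le_div_iff₀' hε]
  calc _ ≤ bracket (v o) + ‖∑ j ∈ S, v j‖ := bracket_add_le _ _
    _ ≤ (ε⁻¹ + S.card) * ‖v i‖ := by linarith
    _ ≤ _ := mul_le_mul_of_nonneg_left (norm_le_bracket _) (by positivity)

theorem norm_splitTerm_le {φ : Q → ι → E →L[ℝ] ℂ} {o i : ι} {r : ℝ} {W : Q → ℝ}
    (hW : ∀ p, 0 ≤ W p) {a : Q → E → F} {l P l' : List ι} (hl : (o :: i :: l).Nodup)
    (hperm : l.Perm (P ++ l')) (hb : HasSymbolBound φ o r W a l') {ε : ℝ} (hε : 0 < ε) :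
    ∃ C : ℝ, 0 ≤ C ∧ ∀ p, ∀ v : ι → E, (∀ j ∈ l, ‖v j‖ ≤ ‖v i‖) → ε * bracket (v o) ≤ ‖v i‖ →
      ‖splitTerm (φ p) o i (a p) (P, l') v‖ ≤
        C * W p * symbolBound (φ p) o r (insert i l.toFinset) v := by
  obtain ⟨C, hC, hb⟩ := hb
  have hnd := ((hperm.cons i).cons o).nodup_iff.1 hl
  simp only [List.nodup_cons, List.mem_cons, not_or, List.mem_append, List.nodup_append] at hnd
  obtain ⟨⟨hoi, hoP, hol'⟩, ⟨hiP, hil'⟩, hP, hl'nd, hPl'⟩ := hnd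
  have hset : l.toFinset = P.toFinset ∪ l'.toFinset := by
    rw [List.toFinset_eq_of_perm _ _ hperm, List.toFinset_append]
  have hdisj : Disjoint P.toFinset l'.toFinset := by
    rw [Finset.disjoint_left]
    intro k hk hk'
    exact hPl' k (by simpa using hk) k (by simpa using hk') rfl
  have hiP' : i ∉ P.toFinset := by simpa using hiP
  have hi' : i ∉ l.toFinset := by simp [hset, hiP, hil']
  set N : ℝ := ε⁻¹ + (insert i P.toFinset).card with hN
  refine ⟨P.length.factorial * N * C, by positivity, fun p v hv hvi => ?_⟩
  set c : E := v i + ∑ k ∈ P.toFinset, v k with hc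
  have hcsum : c = ∑ k ∈ insert i P.toFinset, v k := by rw [Finset.sum_insert hiP']
  have hM : ‖pathFactor (φ p) o i P v‖ ≤ (P.length.factorial : ℝ) *
      (‖φ p i‖ * ∏ j ∈ P.toFinset, ‖φ p j‖) *
        (bracket (v o) * ∏ j ∈ P.toFinset, bracket (v j)) := by
    refine (norm_pathFactor_le (φ p) o i (by simp [hoP, hP]) v).trans ?_
    have h1 : ∏ j ∈ P.toFinset, ‖v j‖ ≤ ∏ j ∈ P.toFinset, bracket (v j) :=
      Finset.prod_le_prod (fun _ _ => norm_nonneg _) fun _ _ => norm_le_bracket _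
    have h2 := norm_le_bracket (v o)
    have h3 := bracket_pos (v o)
    gcongr
  have hsym := hb p (v + Pi.single o c)
  have e1 : (v + (Pi.single o c : ι → E)) o = v o + c := by simp
  have hprod : ∏ j ∈ l'.toFinset, bracket ((v + (Pi.single o c : ι → E)) j) =
      ∏ j ∈ l'.toFinset, bracket (v j) := by
    refine Finset.prod_congr rfl fun j hj => ?_
    have : j ≠ o := by rintro rfl; exact hol' (by simpa using hj)
    simp [this]
  have hbr : bracket (v o + c) ≤ N * bracket (v i) := by
    rw [hcsum]
    refine bracket_add_sum_le hε hvi _ fun j hj => ?_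
    rcases Finset.mem_insert.1 hj with rfl | hj
    · exact le_rfl
    · exact hv j (hperm.mem_iff.2 (by simp at hj; simp [hj]))
  have hsum : ∑ S ∈ l'.toFinset.powerset,
      bracket ((v + (Pi.single o c : ι → E)) o +
        ∑ j ∈ S, (v + (Pi.single o c : ι → E)) j) ^ (r - 1) ≤
      ∑ S ∈ (insert i l.toFinset).powerset, bracket (v o + ∑ j ∈ S, v j) ^ (r - 1) := by
    have hd : ∀ S ⊆ l'.toFinset, Disjoint (insert i P.toFinset) S := fun S hS => by
      refine Finset.disjoint_of_subset_right hS ?_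
      rw [Finset.disjoint_insert_left]
      exact ⟨by simpa using hil', hdisj⟩
    have hinj : Set.InjOn (fun S => insert i P.toFinset ∪ S) l'.toFinset.powerset := by
      intro S hS T hT hST
      simp only [Finset.coe_powerset, Set.mem_preimage, Set.mem_powerset_iff,
        Finset.coe_subset] at hS hT
      have h1 := congrArg (· \ insert i P.toFinset) hST
      simpa only [Finset.union_sdiff_cancel_left (hd S hS),
        Finset.union_sdiff_cancel_left (hd T hT)] using h1
    calc _ = ∑ S ∈ l'.toFinset.powerset,
          bracket (v o + ∑ j ∈ insert i P.toFinset ∪ S, v j) ^ (r - 1) := by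
          refine Finset.sum_congr rfl fun S hS => ?_
          have hS' : S ⊆ l'.toFinset := Finset.mem_powerset.1 hS
          have hs : ∑ j ∈ S, (v + (Pi.single o c : ι → E)) j = ∑ j ∈ S, v j := by
            refine Finset.sum_congr rfl fun j hj => ?_
            have : j ≠ o := by rintro rfl; exact hol' (by simpa using hS' hj)
            simp [this]
          rw [Finset.sum_union (hd S hS'), ← hcsum, ← add_assoc, hs, e1]
      _ = ∑ T ∈ l'.toFinset.powerset.image (fun S => insert i P.toFinset ∪ S),
          bracket (v o + ∑ j ∈ T, v j) ^ (r - 1) :=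
          (Finset.sum_image (f := fun T => bracket (v o + ∑ j ∈ T, v j) ^ (r - 1)) hinj).symm
      _ ≤ _ := by
          refine Finset.sum_le_sum_of_subset_of_nonneg ?_ fun _ _ _ =>
            Real.rpow_nonneg (bracket_pos _).le _
          intro T hT
          simp only [Finset.mem_image, Finset.mem_powerset] at hT ⊢
          obtain ⟨S, hS, rfl⟩ := hT
          rw [hset, Finset.insert_union]
          exact Finset.insert_subset_insert _ (Finset.union_subset_union_right hS)
  rw [splitTerm, norm_smul]
  rw [symbolBound, hprod] at hsym
  rw [symbolBound, Finset.prod_insert hi', Finset.prod_insert hi', hset, Finset.prod_union hdisj,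
    Finset.prod_union hdisj, ← hset]
  set T := ∑ S ∈ (insert i l.toFinset).powerset, bracket (v o + ∑ j ∈ S, v j) ^ (r - 1)
  have h1 := prod_bracket_nonneg l'.toFinset v
  have h2 := prod_bracket_nonneg P.toFinset v
  have h3 := bracket_pos (v o)
  have h4 := bracket_pos (v i)
  have h5 := hW p
  have hN0 : 0 ≤ N := by positivity
  have hT0 : 0 ≤ T := Finset.sum_nonneg fun _ _ => Real.rpow_nonneg (bracket_pos _).le _
  have hsym' : ‖iterSymbol (φ p) o (a p) l' (v + Pi.single o c)‖ ≤ C * W p *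
      ((∏ j ∈ l'.toFinset, ‖φ p j‖) * ((N * bracket (v i)) * ∏ j ∈ l'.toFinset, bracket (v j)) *
        T) := by
    refine hsym.trans ?_
    rw [e1] at hsum ⊢
    gcongr
    exact Finset.sum_nonneg fun _ _ => Real.rpow_nonneg (bracket_pos _).le _
  calc _ ≤ _ := mul_le_mul hM hsym' (norm_nonneg _) (by positivity)
    _ = _ := by ring

omit [DecidableEq ι] [NormedAddCommGroup E] [NormedSpace ℝ E] [NormedSpace ℂ F] in
theorem exists_norm_listSum_le {α : Type*} {R : Q → (ι → E) → Prop} {B : Q → (ι → E) → ℝ}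
    (L : List α) (f : α → Q → (ι → E) → F)
    (h : ∀ x ∈ L, ∃ C : ℝ, 0 ≤ C ∧ ∀ p v, R p v → ‖f x p v‖ ≤ C * B p v) :
    ∃ C : ℝ, 0 ≤ C ∧ ∀ p v, R p v → ‖(L.map fun x => f x p v).sum‖ ≤ C * B p v := by
  induction L with
  | nil => exact ⟨0, le_rfl, by simp⟩
  | cons x L ih =>
    obtain ⟨C, hC, h1⟩ := h x (by simp)
    obtain ⟨D, hD, h2⟩ := ih fun y hy => h y (by simp [hy])
    refine ⟨C + D, by positivity, fun p v hv => ?_⟩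
    rw [List.map_cons, List.sum_cons, add_mul]
    exact (norm_add_le _ _).trans (add_le_add (h1 p v hv) (h2 p v hv))

theorem norm_iterSymbol_le_of_large {φ : Q → ι → E →L[ℝ] ℂ} {o i : ι} {r : ℝ} {W : Q → ℝ}
    (hW : ∀ p, 0 ≤ W p) {a : Q → E → F} {l : List ι} (hl : (o :: i :: l).Nodup)
    (hb : ∀ l', l'.length ≤ l.length → (o :: l').Nodup → HasSymbolBound φ o r W a l')
    (hb' : HasSymbolBound φ o (r + 1) (fun p => ‖φ p i‖ * W p) (fun p ζ => φ p i ζ • a p ζ) l)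
    {ε : ℝ} (hε : 0 < ε) :
    ∃ C : ℝ, 0 ≤ C ∧ ∀ p, ∀ v : ι → E, (∀ j ∈ l, ‖v j‖ ≤ ‖v i‖) ∧ ε * bracket (v o) ≤ ‖v i‖ →
      ‖iterSymbol (φ p) o (a p) (l ++ [i]) v‖ ≤
        C * (W p * symbolBound (φ p) o r (insert i l.toFinset) v) := by
  have hi' : i ∉ l.toFinset := by
    simp only [List.nodup_cons] at hl; simpa using hl.2.1
  obtain ⟨C₁, hC₁, h₁⟩ := exists_norm_listSum_le (Q := Q)
    (R := fun _ v => (∀ j ∈ l, ‖v j‖ ≤ ‖v i‖) ∧ ε * bracket (v o) ≤ ‖v i‖)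
    (B := fun p v => W p * symbolBound (φ p) o r (insert i l.toFinset) v)
    (splits l) (fun x p v => splitTerm (φ p) o i (a p) x v) (fun x hx => by
      have hperm := perm_of_mem_splits hx
      have hnd := ((hperm.cons i).cons o).nodup_iff.1 hl
      have hnd' : (o :: x.2).Nodup := by
        simp only [List.nodup_cons, List.mem_cons, not_or, List.mem_append,
          List.nodup_append] at hnd ⊢
        tauto
      have hlen : x.2.length ≤ l.length := by
        rw [hperm.length_eq, List.length_append]; omega
      obtain ⟨C, hC, h⟩ := norm_splitTerm_le hW hl hperm (hb _ hlen hnd') hε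
      exact ⟨C, hC, fun p v hv => by rw [← mul_assoc]; exact h p v hv.1 hv.2⟩)
  obtain ⟨C₂, hC₂, h₂⟩ := hb'
  set N : ℝ := ε⁻¹ + l.length with hN
  refine ⟨C₁ + C₂ * N, by positivity, fun p v hv => ?_⟩
  rw [iterSymbol_append_singleton (φ p) (a p) hl, add_mul]
  refine (norm_sub_le _ _).trans (add_le_add (h₁ p v hv) ((h₂ p v).trans ?_))
  have hsum : ∑ S ∈ l.toFinset.powerset, bracket (v o + ∑ j ∈ S, v j) ^ (r + 1 - 1) ≤
      (N * bracket (v i)) *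
        ∑ S ∈ (insert i l.toFinset).powerset, bracket (v o + ∑ j ∈ S, v j) ^ (r - 1) := by
    rw [Finset.mul_sum]
    refine (Finset.sum_le_sum fun S hS => ?_).trans
      (Finset.sum_le_sum_of_subset_of_nonneg
        (Finset.powerset_mono.2 (Finset.subset_insert i l.toFinset)) fun S _ _ => ?_)
    · have hS' := Finset.mem_powerset.1 hS
      have hcard : (S.card : ℝ) ≤ l.length := by
        exact_mod_cast (Finset.card_le_card hS').trans l.toFinset_card_le
      have h1 := bracket_add_sum_le hε hv.2 S fun j hj => hv.1 j (by simpa using hS' hj)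
      have h2 := bracket_pos (v i)
      have h3 := bracket_pos (v o + ∑ j ∈ S, v j)
      rw [show r + 1 - 1 = 1 + (r - 1) by ring, Real.rpow_add h3, Real.rpow_one]
      refine mul_le_mul_of_nonneg_right (h1.trans ?_) (Real.rpow_nonneg h3.le _)
      exact mul_le_mul_of_nonneg_right (by rw [hN]; linarith) h2.le
    · have h2 := bracket_pos (v i)
      exact mul_nonneg (by positivity) (Real.rpow_nonneg (bracket_pos _).le _)
  rw [symbolBound, symbolBound, Finset.prod_insert hi', Finset.prod_insert hi']
  have h1 := prod_bracket_nonneg l.toFinset v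
  have h3 := bracket_pos (v o)
  have h5 := hW p
  calc _ ≤ C₂ * (‖φ p i‖ * W p) * ((∏ j ∈ l.toFinset, ‖φ p j‖) *
        (bracket (v o) * ∏ j ∈ l.toFinset, bracket (v j)) *
        ((N * bracket (v i)) *
          ∑ S ∈ (insert i l.toFinset).powerset, bracket (v o + ∑ j ∈ S, v j) ^ (r - 1))) := by
        gcongr
    _ = _ := by ring

omit [DecidableEq ι] in
theorem symbolBound_nonneg (φ : ι → E →L[ℝ] ℂ) (o : ι) (r : ℝ) (s : Finset ι) (v : ι → E) :
    0 ≤ symbolBound φ o r s v :=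
  mul_nonneg (mul_nonneg (Finset.prod_nonneg fun _ _ => norm_nonneg _)
    (mul_nonneg (bracket_pos _).le (prod_bracket_nonneg s v)))
    (Finset.sum_nonneg fun _ _ => Real.rpow_nonneg (bracket_pos _).le _)

theorem hasSymbolBound [Fintype ι] (φ : Q → ι → E →L[ℝ] ℂ) (o : ι) {r : ℝ} {W : Q → ℝ}
    (hW : ∀ p, 0 ≤ W p) {a : Q → E → F} (ha : IsSymbolOn Set.univ bracket r W a) {l : List ι}
    (hl : (o :: l).Nodup) : HasSymbolBound φ o r W a l := by
  induction hn : l.length using Nat.strong_induction_on generalizing r W a l with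
  | _ n ih =>
  obtain ⟨ε, hε, C₀, hC₀, h₀⟩ := norm_iterSymbol_le_of_small hW ha φ hl
  have hlarge : ∀ i ∈ l, ∃ C : ℝ, 0 ≤ C ∧ ∀ p, ∀ v : ι → E,
      (∀ j ∈ l, ‖v j‖ ≤ ‖v i‖) ∧ ε * bracket (v o) ≤ ‖v i‖ →
      ‖iterSymbol (φ p) o (a p) l v‖ ≤ C * (W p * symbolBound (φ p) o r l.toFinset v) := by
    intro i hi
    have hperm : l.Perm (i :: l.erase i) := List.perm_cons_erase hi
    have hnd : (o :: i :: l.erase i).Nodup := (hperm.cons o).nodup_iff.1 hl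
    have hnd' : (o :: l.erase i).Nodup := by
      simp only [List.nodup_cons, List.mem_cons, not_or] at hnd ⊢; tauto
    have hlen : (l.erase i).length < n := by
      rw [← hn, hperm.length_eq, List.length_cons]; omega
    have hsym : IsSymbolOn Set.univ bracket (r + 1) (fun p => ‖φ p i‖ * W p)
        (fun p ζ => φ p i ζ • a p ζ) := by
      rw [add_comm]
      refine IsSymbolOn.smul (fun v _ => bracket_pos v) ?_ ha
      refine IsSymbolOn.of_linear zero_le_one (fun p => le_rfl) fun p v _ => ?_
      rw [one_mul]
      exact ((φ p i).le_opNorm v).trans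
        (mul_le_mul_of_nonneg_left (norm_le_bracket v) (norm_nonneg _))
    obtain ⟨C, hC, h⟩ := norm_iterSymbol_le_of_large hW hnd
      (fun l' hl' hnd' => ih _ (hl'.trans_lt hlen) hW ha hnd' rfl)
      (ih _ hlen (fun p => mul_nonneg (norm_nonneg _) (hW p)) hsym hnd' rfl) hε
    have hset : l.toFinset = insert i (l.erase i).toFinset := by
      rw [List.toFinset_eq_of_perm _ _ hperm, List.toFinset_cons]
    refine ⟨C, hC, fun p v hv => ?_⟩
    rw [iterSymbol_perm (φ p) o (a p) (hperm.trans (List.perm_append_singleton i _).symm) hl, hset]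
    exact h p v ⟨fun j hj => hv.1 j (List.mem_of_mem_erase hj), hv.2⟩
  choose! C hC h using hlarge
  have hCsum : 0 ≤ ∑ i ∈ l.toFinset, C i :=
    Finset.sum_nonneg fun i hi => hC i (by simpa using hi)
  refine ⟨C₀ + ∑ i ∈ l.toFinset, C i, by positivity, fun p v => ?_⟩
  have hB := mul_nonneg (hW p) (symbolBound_nonneg (φ p) o r l.toFinset v)
  rw [mul_assoc]
  by_cases hv : ∀ j ∈ l, ‖v j‖ ≤ ε * bracket (v o)
  · have h1 : ∏ j ∈ l.toFinset, ‖v j‖ ≤ ∏ j ∈ l.toFinset, bracket (v j) :=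
      Finset.prod_le_prod (fun _ _ => norm_nonneg _) fun _ _ => norm_le_bracket _
    have h2 : bracket (v o) ^ (r - 1) ≤
        ∑ S ∈ l.toFinset.powerset, bracket (v o + ∑ j ∈ S, v j) ^ (r - 1) := by
      have := Finset.single_le_sum
        (f := fun S => bracket (v o + ∑ j ∈ S, v j) ^ (r - 1))
        (fun S _ => Real.rpow_nonneg (bracket_pos _).le _) (Finset.empty_mem_powerset l.toFinset)
      simpa using this
    have h3 := bracket_pos (v o)
    have h4 := hW p
    have h5 := prod_bracket_nonneg l.toFinset v
    have h6 : bracket (v o) ^ r = bracket (v o) * bracket (v o) ^ (r - 1) := by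
      conv_lhs => rw [show r = 1 + (r - 1) by ring, Real.rpow_add h3, Real.rpow_one]
    have hbound := h₀ p v hv
    rw [← List.prod_toFinset _ (List.nodup_cons.1 hl).2,
      ← List.prod_toFinset _ (List.nodup_cons.1 hl).2, h6] at hbound
    refine hbound.trans ?_
    calc _ ≤ C₀ * W p * (∏ j ∈ l.toFinset, ‖φ p j‖) * (∏ j ∈ l.toFinset, bracket (v j)) *
          (bracket (v o) *
            ∑ S ∈ l.toFinset.powerset, bracket (v o + ∑ j ∈ S, v j) ^ (r - 1)) := by
          gcongr
      _ = C₀ * (W p * symbolBound (φ p) o r l.toFinset v) := by rw [symbolBound]; ring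
      _ ≤ _ := mul_le_mul_of_nonneg_right (by linarith) hB
  · push Not at hv
    obtain ⟨j, hj, hjv⟩ := hv
    obtain ⟨i, hi, hmax⟩ := Finset.exists_max_image l.toFinset (fun k => ‖v k‖)
      ⟨j, by simpa using hj⟩
    have hi' : i ∈ l := by simpa using hi
    refine (h i hi' p v ⟨fun k hk => hmax k (by simpa using hk),
      hjv.le.trans (hmax j (by simpa using hj))⟩).trans ?_
    refine mul_le_mul_of_nonneg_right ?_ hB
    have := Finset.single_le_sum (f := C) (fun k hk => hC k (by simpa using hk)) hi
    linarith

end MainBound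

theorem norm_dotC_le (ξ : EuclideanSpace ℝ (Fin d)) (X : EuclideanSpace ℂ (Fin d)) :
    ‖dotC d ξ X‖ ≤ ‖X‖ * ‖ξ‖ := by
  rw [mul_comm, EuclideanSpace.norm_eq, EuclideanSpace.norm_eq]
  calc ‖dotC d ξ X‖ ≤ ∑ i, ‖(ξ i : ℂ) * X i‖ := norm_sum_le _ _
    _ = ∑ i, ‖ξ i‖ * ‖X i‖ := by simp
    _ ≤ _ := Real.sum_mul_le_sqrt_mul_sqrt _ _ _

/-- The pairing `dotC` as a continuous linear functional of its first argument. -/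
def dotCLM (X : EuclideanSpace ℂ (Fin d)) : EuclideanSpace ℝ (Fin d) →L[ℝ] ℂ :=
  LinearMap.mkContinuous
    { toFun := fun ξ => dotC d ξ X
      map_add' := fun ξ η => by simp [dotC, add_mul, Finset.sum_add_distrib]
      map_smul' := fun c ξ => by simp [dotC, mul_assoc, Finset.mul_sum] }
    ‖X‖ fun ξ => norm_dotC_le d ξ X

theorem norm_dotCLM_le (X : EuclideanSpace ℂ (Fin d)) : ‖dotCLM d X‖ ≤ ‖X‖ :=
  LinearMap.mkContinuous_norm_le _ (norm_nonneg _) _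

theorem lamW_eq_bracket_rpow (s : ℝ) (ξ : EuclideanSpace ℝ (Fin d)) :
    lamW d s ξ = bracket ξ ^ s := by
  rw [lamW, bracket, Real.sqrt_eq_rpow, ← Real.rpow_mul (by positivity)]
  congr 1
  ring

theorem sum_insert_toFinset_reverse_ofFn {ι M : Type*} [DecidableEq ι] [AddCommMonoid M] {n : ℕ}
    {e : Fin (n + 1) → ι} (he : Function.Injective e) (g : ι → M) :
    ∑ k ∈ insert (e 0) (List.ofFn fun i : Fin n => e i.succ).reverse.toFinset, g k =
      ∑ k, g (e k) := by
  have : insert (e 0) (List.ofFn fun i : Fin n => e i.succ).reverse.toFinset =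
      Finset.univ.image e := by
    ext k
    simp only [Finset.mem_insert, List.toFinset_reverse, List.mem_toFinset, List.mem_ofFn,
      Finset.mem_image, Finset.mem_univ, true_and, Fin.exists_fin_succ]
    simp [eq_comm]
  rw [this, Finset.sum_image he.injOn]

theorem aN_eq_iterSymbol {ι : Type*} [DecidableEq ι]
    (a : EuclideanSpace ℝ (Fin d) →
      (EuclideanSpace ℂ (Fin d) →L[ℂ] EuclideanSpace ℂ (Fin d)))
    {n : ℕ} {e : Fin (n + 1) → ι} (he : Function.Injective e)
    (ξ : ι → EuclideanSpace ℝ (Fin d)) (X : ι → EuclideanSpace ℂ (Fin d)) :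
    aN d a n (fun k => ξ (e k)) (fun k => X (e k)) =
      (((2 * Real.pi : ℝ) : ℂ) * Complex.I) ^ n •
        iterSymbol (fun j => dotCLM d (X j)) (e 0) a
          (List.ofFn fun i : Fin n => e i.succ).reverse ξ (X (e 0)) := by
  induction n generalizing ξ with
  | zero => simp [aN, iterSymbol]
  | succ n ih =>
    have he' : Function.Injective fun k : Fin (n + 1) => e k.castSucc :=
      he.comp (Fin.castSucc_injective _)
    have hlist : (List.ofFn fun i : Fin (n + 1) => e i.succ).reverse =
        e (Fin.last (n + 1)) :: (List.ofFn fun i : Fin n => e i.succ.castSucc).reverse := by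
      rw [List.ofFn_succ', List.concat_eq_append, List.reverse_append]
      simp only [Fin.succ_last, List.reverse_cons, List.reverse_nil, List.nil_append,
        List.singleton_append, ← Fin.succ_castSucc]
    have hupd : ∀ k : Fin (n + 1), Function.update (fun j : Fin (n + 1) => ξ (e j.castSucc)) k
        (ξ (e k.castSucc) + ξ (e (Fin.last (n + 1)))) = fun j : Fin (n + 1) =>
          (ξ + Pi.single (e k.castSucc) (ξ (e (Fin.last (n + 1)))) :
            ι → EuclideanSpace ℝ (Fin d)) (e j.castSucc) := by
      intro k
      funext j
      by_cases hj : j = k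
      · subst hj; simp
      · have : e j.castSucc ≠ e k.castSucc := fun h => hj (he' h)
        simp [hj, this]
    have hsum := sum_insert_toFinset_reverse_ofFn he' fun k =>
      dotCLM d (X (e (Fin.last (n + 1)))) (ξ k) •
        (iterSymbol (fun j => dotCLM d (X j)) (e 0) a
          (List.ofFn fun i : Fin n => e i.succ.castSucc).reverse
            (ξ + Pi.single k (ξ (e (Fin.last (n + 1))))) -
        iterSymbol (fun j => dotCLM d (X j)) (e 0) a
          (List.ofFn fun i : Fin n => e i.succ.castSucc).reverse ξ)
    rw [hlist, iterSymbol, shiftDeriv]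
    simp only [Fin.castSucc_zero] at hsum ih
    rw [hsum, aN]
    generalize ((2 * Real.pi : ℝ) : ℂ) * Complex.I = c at ih ⊢
    rw [pow_succ', mul_smul]
    congr 1
    rw [_root_.sum_apply, Finset.smul_sum]
    refine Finset.sum_congr rfl fun k _ => ?_
    have h1 := ih he' (ξ + Pi.single (e k.castSucc) (ξ (e (Fin.last (n + 1)))))
    have h2 := ih he' ξ
    simp only [Fin.castSucc_zero] at h1 h2
    rw [hupd, h1, h2, ← smul_sub, smul_comm]
    rfl

/-- The estimate on the derived symbols `a_n`: for a smooth symbol `a` of class `S^r`,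
`r ≥ 1`, one has `‖a_n(ξ₀,…,ξ_n)‖ ≤ C_n (∏_k λ₁(ξ_k)) ∑_{J⊆{1,…,n}} λ_{r−1}(ξ₀+∑_{j∈J}ξ_j)`
in the sense of the corresponding multilinear operator norms. -/
theorem aN_estimate (r : ℝ) (hr : 1 ≤ r)
    (a : EuclideanSpace ℝ (Fin d) →
      (EuclideanSpace ℂ (Fin d) →L[ℂ] EuclideanSpace ℂ (Fin d)))
    (ha_smooth : ContDiff ℝ (⊤ : ℕ∞) a)
    (ha : ∀ m : ℕ, ∃ C > 0, ∀ ξ,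
      ‖iteratedFDeriv ℝ m a ξ‖ ≤ C * lamW d (r - m) ξ) :
    ∀ n : ℕ, ∃ C > 0,
      ∀ (ξ : Fin (n + 1) → EuclideanSpace ℝ (Fin d))
        (X : Fin (n + 1) → EuclideanSpace ℂ (Fin d)),
        ‖aN d a n ξ X‖ ≤ C * (∏ k, lamW d 1 (ξ k)) *
          (∑ J ∈ (Finset.univ : Finset (Fin n)).powerset,
            lamW d (r - 1) (ξ 0 + ∑ j ∈ J, ξ j.succ)) *
          ∏ k, ‖X k‖ := by
  intro n
  have hsymb : IsSymbolOn (P := Fin (n + 1) → EuclideanSpace ℂ (Fin d)) Set.univ bracket r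
      (fun _ => 1) (fun _ => a) := by
    refine ⟨fun _ => ha_smooth, fun m => ?_⟩
    obtain ⟨C, hC, h⟩ := ha m
    refine ⟨C, hC.le, fun _ ξ _ => ?_⟩
    rw [mul_one, ← lamW_eq_bracket_rpow]
    exact h ξ
  set l : List (Fin (n + 1)) := (List.ofFn fun i : Fin n => i.succ).reverse with hl
  have hset : l.toFinset = Finset.univ.map (Fin.succEmb n) := by
    ext k; simp [hl]
  have hnd : ((0 : Fin (n + 1)) :: l).Nodup := by
    rw [List.nodup_cons, hl, List.nodup_reverse, List.nodup_ofFn]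
    exact ⟨by simp [Fin.succ_ne_zero], Fin.succ_injective n⟩
  obtain ⟨C, hC, h⟩ := hasSymbolBound (fun (X : Fin (n + 1) → EuclideanSpace ℂ (Fin d)) j =>
    dotCLM d (X j)) 0 (fun _ => zero_le_one) hsymb hnd
  refine ⟨(2 * Real.pi) ^ n * (C + 1), by positivity, fun ξ X => ?_⟩
  have hsum : ∑ S ∈ l.toFinset.powerset, bracket (ξ 0 + ∑ j ∈ S, ξ j) ^ (r - 1) =
      ∑ J ∈ (Finset.univ : Finset (Fin n)).powerset,
        lamW d (r - 1) (ξ 0 + ∑ j ∈ J, ξ j.succ) := by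
    rw [hset, Finset.map_eq_image, Finset.powerset_image, Finset.sum_image
      (Finset.image_injective (Fin.succEmb n).injective).injOn]
    refine Finset.sum_congr rfl fun J _ => ?_
    rw [lamW_eq_bracket_rpow]
    congr 3
    exact Finset.sum_image (Fin.succEmb n).injective.injOn
  have hbr : bracket (ξ 0) * ∏ j ∈ l.toFinset, bracket (ξ j) = ∏ k, lamW d 1 (ξ k) := by
    rw [hset, Finset.prod_map, Fin.prod_univ_succ]
    simp [lamW_eq_bracket_rpow]
  have hφ : ∏ j ∈ l.toFinset, ‖dotCLM d (X j)‖ ≤ ∏ j : Fin n, ‖X j.succ‖ := by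
    rw [hset, Finset.prod_map]
    exact Finset.prod_le_prod (fun _ _ => norm_nonneg _) fun _ _ => norm_dotCLM_le d _
  have hB : 0 ≤ ∏ k, lamW d 1 (ξ k) :=
    hbr ▸ mul_nonneg (bracket_pos _).le (prod_bracket_nonneg _ _)
  have hS : 0 ≤ ∑ J ∈ (Finset.univ : Finset (Fin n)).powerset,
      lamW d (r - 1) (ξ 0 + ∑ j ∈ J, ξ j.succ) :=
    hsum ▸ Finset.sum_nonneg fun _ _ => Real.rpow_nonneg (bracket_pos _).le _
  have hmain := h X ξ
  rw [symbolBound, hsum, hbr, mul_one] at hmain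
  have heq := aN_eq_iterSymbol d a (Function.injective_id (α := Fin (n + 1))) ξ X
  simp only [id_eq, ← hl] at heq
  rw [heq, norm_smul, norm_pow, Fin.prod_univ_succ (f := fun k => ‖X k‖)]
  have hc : ‖((2 * Real.pi : ℝ) : ℂ) * Complex.I‖ = 2 * Real.pi := by
    rw [norm_mul, Complex.norm_I, mul_one, Complex.norm_real,
      Real.norm_of_nonneg (by positivity)]
  rw [hc]
  have hop : ‖iterSymbol (fun j => dotCLM d (X j)) 0 a l ξ (X 0)‖ ≤
      (C * ((∏ j : Fin n, ‖X j.succ‖) * (∏ k, lamW d 1 (ξ k)) *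
        ∑ J ∈ (Finset.univ : Finset (Fin n)).powerset,
          lamW d (r - 1) (ξ 0 + ∑ j ∈ J, ξ j.succ))) * ‖X 0‖ := by
    refine (ContinuousLinearMap.le_opNorm _ _).trans ?_
    refine mul_le_mul_of_nonneg_right (hmain.trans ?_) (norm_nonneg _)
    gcongr
  calc _ ≤ (2 * Real.pi) ^ n * (((C + 1) * ((∏ j : Fin n, ‖X j.succ‖) * (∏ k, lamW d 1 (ξ k)) *
        ∑ J ∈ (Finset.univ : Finset (Fin n)).powerset,
          lamW d (r - 1) (ξ 0 + ∑ j ∈ J, ξ j.succ))) * ‖X 0‖) := by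
        refine mul_le_mul_of_nonneg_left (hop.trans ?_) (by positivity)
        gcongr
        linarith
    _ = _ := by ring

end
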